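/- Define K(t,s) := min(t,s) − t·s − φ(Φ⁻¹(t))φ(Φ⁻¹(s)) − (1/2)Φ⁻¹(t)φ(Φ⁻¹(t))·Φ⁻¹(s)φ(Φ⁻¹(s)) for t, s ∈ (0,1), where Φ is the standard normal distribution function, φ = Φ' its density, and Φ⁻¹ the inverse of Φ. Then K is positive semidefinite: for every m ≥ 1, all t₁,...,t_m ∈ (0,1) and all a₁,...,a_m ∈ ℝ, Σ_{i=1}^m Σ_{j=1}^m a_i a_j K(t_i,t_j) ≥ 0. -/

import Mathlib

open MeasureTheory ProbabilityTheory Set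

/-- The standard normal distribution function `Φ`. -/
noncomputable def stdNormalCDF : ℝ → ℝ := fun x => cdf (gaussianReal 0 1) x

/-- The standard normal density `φ(x) = (2π)^{-1/2} e^{-x²/2}`. -/
noncomputable def stdNormalPDF : ℝ → ℝ :=
  fun x => (Real.sqrt (2 * Real.pi))⁻¹ * Real.exp (-(x ^ 2) / 2)

/-- The inverse `Φ⁻¹ : (0,1) → ℝ` of the standard normal distribution function. -/
noncomputable def stdNormalQuantile : ℝ → ℝ := Function.invFun stdNormalCDF

/-- The covariance function
`K(t,s) = min(t,s) - ts - φ(Φ⁻¹(t))φ(Φ⁻¹(s)) - ½ Φ⁻¹(t)φ(Φ⁻¹(t)) Φ⁻¹(s)φ(Φ⁻¹(s))` of the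
limiting residual empirical process. -/
noncomputable def limitCov (t s : ℝ) : ℝ :=
  min t s - t * s - stdNormalPDF (stdNormalQuantile t) * stdNormalPDF (stdNormalQuantile s)
    - (1 / 2) * stdNormalQuantile t * stdNormalPDF (stdNormalQuantile t)
      * (stdNormalQuantile s * stdNormalPDF (stdNormalQuantile s))

open Filter Topology in
theorem tendsto_pow_mul_stdNormalPDF (n : ℕ) :
    Tendsto (fun y => y ^ n * stdNormalPDF y) (cocompact ℝ) (𝓝 0) := by
  rw [tendsto_zero_iff_norm_tendsto_zero]
  have h := (tendsto_rpow_abs_mul_exp_neg_mul_sq_cocompact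
    (show (0 : ℝ) < 1 / 2 by norm_num) n).const_mul (Real.sqrt (2 * Real.pi))⁻¹
  rw [mul_zero] at h
  refine h.congr fun y => ?_
  have hs : 0 ≤ (Real.sqrt (2 * Real.pi))⁻¹ := by positivity
  rw [stdNormalPDF, norm_mul, norm_mul, norm_pow, Real.norm_eq_abs, Real.norm_eq_abs,
    Real.norm_eq_abs, abs_of_nonneg hs, Real.abs_exp, Real.rpow_natCast,
    show -(1 / 2) * y ^ 2 = -(y ^ 2) / 2 by ring]
  ring

theorem integrable_pow_mul_stdNormalPDF (n : ℕ) :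
    Integrable (fun y => y ^ n * stdNormalPDF y) := by
  have h := (integrable_rpow_mul_exp_neg_mul_sq (show (0 : ℝ) < 1 / 2 by norm_num)
    (show (-1 : ℝ) < n by linarith [n.cast_nonneg (α := ℝ)])).const_mul
      (Real.sqrt (2 * Real.pi))⁻¹
  refine h.congr (Filter.Eventually.of_forall fun y => ?_)
  simp only [stdNormalPDF]
  rw [Real.rpow_natCast, show -(1 / 2) * y ^ 2 = -(y ^ 2) / 2 by ring]
  ring

theorem hasDerivAt_stdNormalPDF (y : ℝ) :
    HasDerivAt stdNormalPDF (-y * stdNormalPDF y) y := by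
  have h : HasDerivAt (fun x : ℝ => -(x ^ 2) / 2) (-y) y := by
    convert! ((hasDerivAt_pow 2 y).neg.div_const 2) using 1
    ring
  convert! h.exp.const_mul (Real.sqrt (2 * Real.pi))⁻¹ using 1
  simp only [stdNormalPDF]
  ring

theorem hasDerivAt_pow_mul_stdNormalPDF (n : ℕ) (y : ℝ) :
    HasDerivAt (fun y => y ^ n * stdNormalPDF y)
      (n * (y ^ (n - 1) * stdNormalPDF y) - y ^ (n + 1) * stdNormalPDF y) y := by
  convert! (hasDerivAt_pow n y).mul (hasDerivAt_stdNormalPDF y) using 1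
  ring

theorem gaussianPDFReal_zero_one : gaussianPDFReal 0 1 = stdNormalPDF := by
  funext y
  simp [gaussianPDFReal, stdNormalPDF]

theorem integral_gaussianReal_zero_one (f : ℝ → ℝ) :
    ∫ y, f y ∂gaussianReal 0 1 = ∫ y, f y * stdNormalPDF y := by
  rw [integral_gaussianReal_eq_integral_smul one_ne_zero, gaussianPDFReal_zero_one]
  simp [mul_comm]

theorem setIntegral_gaussianReal_zero_one (f : ℝ → ℝ) {s : Set ℝ} (hs : MeasurableSet s) :
    ∫ y in s, f y ∂gaussianReal 0 1 = ∫ y in s, f y * stdNormalPDF y := by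
  rw [← integral_indicator hs, integral_gaussianReal_zero_one, ← integral_indicator hs]
  simp_rw [indicator_mul_left]

theorem integrable_pow_gaussianReal (n : ℕ) :
    Integrable (fun y : ℝ => y ^ n) (gaussianReal 0 1) := by
  have h := (memLp_id_gaussianReal (μ := 0) (v := 1) n).integrable_norm_pow'
  refine h.mono (by fun_prop) (Filter.Eventually.of_forall fun y => ?_)
  simp

theorem integral_pow_succ_gaussianReal (n : ℕ) :
    ∫ y, y ^ (n + 1) ∂gaussianReal 0 1 = n * ∫ y, y ^ (n - 1) ∂gaussianReal 0 1 := by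
  have hc := tendsto_pow_mul_stdNormalPDF n
  rw [cocompact_eq_atBot_atTop, Filter.tendsto_sup] at hc
  have h := integral_of_hasDerivAt_of_tendsto (hasDerivAt_pow_mul_stdNormalPDF n)
    (((integrable_pow_mul_stdNormalPDF _).const_mul _).sub (integrable_pow_mul_stdNormalPDF _))
    hc.1 hc.2
  rw [integral_sub ((integrable_pow_mul_stdNormalPDF _).const_mul _)
    (integrable_pow_mul_stdNormalPDF _), integral_const_mul] at h
  rw [integral_gaussianReal_zero_one, integral_gaussianReal_zero_one]
  linarith

theorem setIntegral_Iic_pow_succ_gaussianReal (n : ℕ) (x : ℝ) :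
    ∫ y in Iic x, y ^ (n + 1) ∂gaussianReal 0 1 =
      n * ∫ y in Iic x, y ^ (n - 1) ∂gaussianReal 0 1 - x ^ n * stdNormalPDF x := by
  have hc := tendsto_pow_mul_stdNormalPDF n
  rw [cocompact_eq_atBot_atTop, Filter.tendsto_sup] at hc
  have hi (k : ℕ) := (integrable_pow_mul_stdNormalPDF k).integrableOn (s := Iic x)
  have h := integral_Iic_of_hasDerivAt_of_tendsto'
    (fun y (_ : y ∈ Iic x) => hasDerivAt_pow_mul_stdNormalPDF n y)
    (((hi _).const_mul _).sub (hi _)) hc.1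
  rw [integral_sub ((hi _).const_mul _) (hi _), integral_const_mul] at h
  rw [setIntegral_gaussianReal_zero_one _ measurableSet_Iic,
    setIntegral_gaussianReal_zero_one _ measurableSet_Iic]
  linarith

theorem setIntegral_Iic_one_gaussianReal (x : ℝ) :
    ∫ _ in Iic x, (1 : ℝ) ∂gaussianReal 0 1 = stdNormalCDF x := by
  simp [stdNormalCDF, cdf_eq_real]

theorem setIntegral_Iic_quadratic_gaussianReal (a b c x : ℝ) :
    ∫ y in Iic x, (a + b * y + c * y ^ 2) ∂gaussianReal 0 1 =
      a * stdNormalCDF x - b * stdNormalPDF x + c * (stdNormalCDF x - x * stdNormalPDF x) := by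
  have h1 := setIntegral_Iic_pow_succ_gaussianReal 0 x
  have h2 := setIntegral_Iic_pow_succ_gaussianReal 1 x
  have hi (k : ℕ) := (integrable_pow_gaussianReal k).integrableOn (s := Iic x)
  have e0 := hi 0
  have e1 := hi 1
  simp only [pow_zero, pow_one, zero_add, Nat.cast_zero, zero_mul, Nat.cast_one, one_mul,
    Nat.sub_self, Nat.reduceAdd, setIntegral_Iic_one_gaussianReal] at h1 h2 e0 e1
  have e0' := e0.const_mul a
  rw [mul_one] at e0'
  rw [integral_add (e0'.fun_add (e1.const_mul b)) ((hi 2).const_mul c),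
    integral_add e0' (e1.const_mul b), integral_const_mul, integral_const_mul, h1, h2,
    ← mul_one a, integral_const_mul, setIntegral_Iic_one_gaussianReal]
  ring

theorem integral_quartic_gaussianReal (a b c d e : ℝ) :
    ∫ y, (a + b * y + c * y ^ 2 + d * y ^ 3 + e * y ^ 4) ∂gaussianReal 0 1 = a + c + 3 * e := by
  have h1 := integral_pow_succ_gaussianReal 0
  have h2 := integral_pow_succ_gaussianReal 1
  have h3 := integral_pow_succ_gaussianReal 2
  have h4 := integral_pow_succ_gaussianReal 3
  have hi := integrable_pow_gaussianReal
  have e1 := hi 1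
  simp only [Nat.cast_zero, zero_mul, pow_one, zero_add, Nat.cast_one, one_mul, Nat.sub_self,
    pow_zero, Nat.reduceAdd, Nat.reduceSub, Nat.cast_ofNat, integral_const, probReal_univ,
    smul_eq_mul] at h1 h2 h3 h4 e1
  rw [h1] at h3
  rw [h2] at h4
  have e0 : Integrable (fun _ : ℝ => a) (gaussianReal 0 1) := integrable_const a
  have f1 := e0.fun_add (e1.const_mul b)
  have f2 := f1.fun_add ((hi 2).const_mul c)
  have f3 := f2.fun_add ((hi 3).const_mul d)
  rw [integral_add f3 ((hi 4).const_mul e), integral_add f2 ((hi 3).const_mul d),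
    integral_add f1 ((hi 2).const_mul c), integral_add e0 (e1.const_mul b),
    integral_const_mul b, h1]
  simp only [integral_const_mul, h2, h3, h4, integral_const, probReal_univ, smul_eq_mul]
  ring

/-- The projection of the centered indicator of `(-∞, x]` onto the orthogonal complement of the
linear and quadratic Hermite polynomials in `L²` of the standard normal distribution. -/
noncomputable def residualIndicator (x y : ℝ) : ℝ :=
  (Iic x).indicator 1 y + ((-stdNormalCDF x - 1 / 2 * x * stdNormalPDF x) +
    stdNormalPDF x * y + 1 / 2 * x * stdNormalPDF x * y ^ 2)

theorem memLp_residualIndicator (x : ℝ) :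
    MemLp (residualIndicator x) 2 (gaussianReal 0 1) := by
  have hp (n : ℕ) : MemLp (fun y : ℝ => y ^ n) 2 (gaussianReal 0 1) := by
    rw [memLp_two_iff_integrable_sq (by fun_prop)]
    simpa only [← pow_mul] using integrable_pow_gaussianReal (n * 2)
  have h1 := hp 1
  simp only [pow_one] at h1
  have hi : MemLp ((Iic x).indicator (1 : ℝ → ℝ)) 2 (gaussianReal 0 1) :=
    (memLp_const (1 : ℝ)).indicator measurableSet_Iic
  have hc : MemLp (fun _ : ℝ => -stdNormalCDF x - 1 / 2 * x * stdNormalPDF x) 2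
    (gaussianReal 0 1) := memLp_const _
  exact hi.add ((hc.add (h1.const_mul (stdNormalPDF x))).add
    ((hp 2).const_mul (1 / 2 * x * stdNormalPDF x)))

theorem integral_residualIndicator_mul (x z : ℝ) :
    ∫ y, residualIndicator x y * residualIndicator z y ∂gaussianReal 0 1 =
      stdNormalCDF (min x z) - stdNormalCDF x * stdNormalCDF z - stdNormalPDF x * stdNormalPDF z
        - (1 / 2) * x * stdNormalPDF x * (z * stdNormalPDF z) := by
  set q : ℝ → ℝ → ℝ := fun x y => (-stdNormalCDF x - 1 / 2 * x * stdNormalPDF x) +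
    stdNormalPDF x * y + 1 / 2 * x * stdNormalPDF x * y ^ 2 with hq
  have hi := integrable_pow_gaussianReal
  have e1 := hi 1
  simp only [pow_one] at e1
  have hqi (x : ℝ) : Integrable (q x) (gaussianReal 0 1) :=
    ((integrable_const _).add (e1.const_mul _)).add ((hi 2).const_mul _)
  have hI (x z : ℝ) : ∫ y, (Iic x).indicator (q z) y ∂gaussianReal 0 1 =
      (-stdNormalCDF z - 1 / 2 * z * stdNormalPDF z) * stdNormalCDF x
      - stdNormalPDF z * stdNormalPDF x
      + 1 / 2 * z * stdNormalPDF z * (stdNormalCDF x - x * stdNormalPDF x) := by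
    rw [integral_indicator measurableSet_Iic, setIntegral_Iic_quadratic_gaussianReal]
  have hm : ∫ y, (Iic (min x z)).indicator (1 : ℝ → ℝ) y ∂gaussianReal 0 1 =
      stdNormalCDF (min x z) := by
    rw [integral_indicator measurableSet_Iic]
    exact setIntegral_Iic_one_gaussianReal _
  have hQ : ∫ y, q x y * q z y ∂gaussianReal 0 1 =
      stdNormalCDF x * stdNormalCDF z + stdNormalPDF x * stdNormalPDF z
        + 1 / 2 * x * stdNormalPDF x * (z * stdNormalPDF z) := by
    set u := -stdNormalCDF x - 1 / 2 * x * stdNormalPDF x with hu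
    set v := -stdNormalCDF z - 1 / 2 * z * stdNormalPDF z with hv
    set r := 1 / 2 * x * stdNormalPDF x with hr
    set w := 1 / 2 * z * stdNormalPDF z with hw
    have := integral_quartic_gaussianReal (u * v)
      (u * stdNormalPDF z + stdNormalPDF x * v)
      (u * w + stdNormalPDF x * stdNormalPDF z + r * v)
      (stdNormalPDF x * w + r * stdNormalPDF z) (r * w)
    rw [show stdNormalCDF x * stdNormalCDF z + stdNormalPDF x * stdNormalPDF z
        + r * (z * stdNormalPDF z) = u * v
        + (u * w + stdNormalPDF x * stdNormalPDF z + r * v) + 3 * (r * w) by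
      rw [hu, hv, hr, hw]; ring, ← this]
    congr 1
    funext y
    simp only [hq]
    ring
  have hmul : (fun y => residualIndicator x y * residualIndicator z y) = fun y =>
      (Iic (min x z)).indicator (1 : ℝ → ℝ) y + (Iic x).indicator (q z) y
        + (Iic z).indicator (q x) y + q x y * q z y := by
    funext y
    change ((Iic x).indicator 1 y + q x y) * ((Iic z).indicator 1 y + q z y) = _
    by_cases hx : y ≤ x <;> by_cases hz : y ≤ z <;>
      simp [indicator, hx, hz] <;> ring
  have i1 : Integrable ((Iic (min x z)).indicator (1 : ℝ → ℝ)) (gaussianReal 0 1) :=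
    (integrable_const (1 : ℝ)).indicator measurableSet_Iic
  have i2 := (hqi z).indicator (measurableSet_Iic (a := x))
  have i3 := (hqi x).indicator (measurableSet_Iic (a := z))
  have i4 : Integrable (fun y => q x y * q z y) (gaussianReal 0 1) := by
    have h := (memLp_residualIndicator x).integrable_mul (memLp_residualIndicator z)
    have h' := ((h.sub i1).sub i2).sub i3
    refine h'.congr (Filter.Eventually.of_forall fun y => ?_)
    have := congrFun hmul y
    simp only [Pi.sub_apply, Pi.mul_apply] at this ⊢
    linarith
  rw [hmul, integral_add ((i1.fun_add i2).fun_add i3) i4, integral_add (i1.fun_add i2) i3,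
    integral_add i1 i2, hm, hI, hI, hQ]
  ring

theorem continuous_stdNormalCDF : Continuous stdNormalCDF := by
  have := nullSingletonClass_gaussianReal (μ := 0) (v := 1) one_ne_zero
  refine continuous_iff_continuousAt.2 fun x => ?_
  have h := (cdf (gaussianReal 0 1)).measure_singleton x
  rw [measure_cdf, measure_singleton, eq_comm, ENNReal.ofReal_eq_zero, sub_nonpos] at h
  have hmono : Monotone stdNormalCDF := monotone_cdf _
  refine hmono.continuousAt_iff_leftLim_eq_rightLim.2 ?_
  exact (le_antisymm (hmono.leftLim_le le_rfl) h).trans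
    ((cdf (gaussianReal 0 1)).rightLim_eq x).symm

theorem stdNormalCDF_stdNormalQuantile {t : ℝ} (ht : t ∈ Ioo (0 : ℝ) 1) :
    stdNormalCDF (stdNormalQuantile t) = t := by
  refine Function.invFun_eq ?_
  obtain ⟨a, ha⟩ := ((tendsto_cdf_atBot (gaussianReal 0 1)).eventually_le_const ht.1).exists
  obtain ⟨b, hb⟩ := ((tendsto_cdf_atTop (gaussianReal 0 1)).eventually_const_le ht.2).exists
  exact mem_range_of_exists_le_of_exists_ge continuous_stdNormalCDF ⟨a, ha⟩ ⟨b, hb⟩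

theorem limitCov_eq_integral {t s : ℝ} (ht : t ∈ Ioo (0 : ℝ) 1) (hs : s ∈ Ioo (0 : ℝ) 1) :
    limitCov t s = ∫ y, residualIndicator (stdNormalQuantile t) y *
      residualIndicator (stdNormalQuantile s) y ∂gaussianReal 0 1 := by
  have hmono : Monotone stdNormalCDF := monotone_cdf _
  rw [integral_residualIndicator_mul, hmono.map_min, stdNormalCDF_stdNormalQuantile ht,
    stdNormalCDF_stdNormalQuantile hs, limitCov]

/-- The covariance function `K` is positive semidefinite on `(0,1)`. -/
theorem limitCov_posSemidef
    (m : ℕ) (hm : 1 ≤ m) (t : Fin m → ℝ) (ht : ∀ i, t i ∈ Set.Ioo (0 : ℝ) 1)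
    (a : Fin m → ℝ) :
    0 ≤ ∑ i : Fin m, ∑ j : Fin m, a i * a j * limitCov (t i) (t j) := by
  have hint (i j : Fin m) : Integrable (fun y => a i * a j *
      (residualIndicator (stdNormalQuantile (t i)) y *
        residualIndicator (stdNormalQuantile (t j)) y)) (gaussianReal 0 1) :=
    ((memLp_residualIndicator _).integrable_mul (memLp_residualIndicator _)).const_mul _
  have h : ∑ i : Fin m, ∑ j : Fin m, a i * a j * limitCov (t i) (t j) =
      ∫ y, (∑ i, a i * residualIndicator (stdNormalQuantile (t i)) y) ^ 2
        ∂gaussianReal 0 1 := by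
    simp_rw [limitCov_eq_integral (ht _) (ht _), ← integral_const_mul, pow_two,
      Finset.sum_mul_sum, mul_mul_mul_comm (a _)]
    rw [integral_finsetSum _ fun i _ => integrable_finsetSum _ fun j _ => hint i j]
    exact Finset.sum_congr rfl fun i _ => (integral_finsetSum _ fun j _ => hint i j).symm
  rw [h]
  exact integral_nonneg fun y => sq_nonneg _
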